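/- Let L : ℝ²ⁿ → ℝ be affine in (x,ξ), say L(x,ξ) = c + p·x + q·ξ with c ∈ ℝ, p, q ∈ ℝⁿ. Then for Schwartz u, the Bargmann transform intertwines the Weyl quantization of L with a first-order differential operator: T(L^w(x,D)u)(x,ξ) = (L(x,ξ) + i(p·∂_ξ − q·(∂_x − iξ))) (Tu)(x,ξ). -/

import Mathlib

open MeasureTheory Complex
open scoped RealInnerProductSpace

noncomputable def bargmann (n : ℕ) (f : EuclideanSpace ℝ (Fin n) → ℂ)
    (x ξ : EuclideanSpace ℝ (Fin n)) : ℂ :=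
  ((2 : ℝ) ^ (-(n : ℝ) / 2) * Real.pi ^ (-(3 * (n : ℝ)) / 4) : ℝ) *
    ∫ y : EuclideanSpace ℝ (Fin n),
      Complex.exp (-((‖x - y‖ : ℂ) ^ 2) / 2) *
        Complex.exp (Complex.I * (⟪ξ, x - y⟫ : ℝ)) * f y

/-- The Gaussian wave packet kernel. -/
noncomputable def bK {n : ℕ} (ξ z : EuclideanSpace ℝ (Fin n)) : ℂ :=
  Complex.exp (-((‖z‖ : ℂ) ^ 2) / 2) * Complex.exp (Complex.I * (⟪ξ, z⟫ : ℝ))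

lemma bK_norm {n : ℕ} (ξ z : EuclideanSpace ℝ (Fin n)) :
    ‖bK ξ z‖ = Real.exp (-(‖z‖ ^ 2) / 2) := by
  have h1 : (-((‖z‖ : ℂ) ^ 2) / 2) = ((-(‖z‖ ^ 2) / 2 : ℝ) : ℂ) := by push_cast; ring
  rw [bK, norm_mul, mul_comm Complex.I, Complex.norm_exp_ofReal_mul_I, mul_one, h1,
    Complex.norm_exp_ofReal]

lemma bK_norm_le {n : ℕ} (ξ z : EuclideanSpace ℝ (Fin n)) : ‖bK ξ z‖ ≤ 1 := by
  rw [bK_norm, Real.exp_le_one_iff]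
  have := sq_nonneg ‖z‖
  linarith

lemma bK_norm_mul_le {n : ℕ} (ξ z : EuclideanSpace ℝ (Fin n)) : ‖bK ξ z‖ * ‖z‖ ≤ 1 := by
  rw [bK_norm, neg_div, Real.exp_neg, inv_mul_le_iff₀ (Real.exp_pos _), mul_one]
  have := Real.add_one_le_exp (‖z‖ ^ 2 / 2)
  nlinarith [sq_nonneg (‖z‖ - 1)]

lemma bK_cont {n : ℕ} (ξ : EuclideanSpace ℝ (Fin n)) : Continuous (bK ξ) := by
  unfold bK
  fun_prop

lemma gauss_int (n : ℕ) :
    Integrable (fun z : EuclideanSpace ℝ (Fin n) => Real.exp (-(‖z‖ ^ 2) / 2)) := by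
  have h := (GaussianFourier.integrable_cexp_neg_mul_sq_norm_add
    (V := EuclideanSpace ℝ (Fin n)) (b := 1 / 2) (by norm_num) 0 0).norm
  refine h.congr (Filter.Eventually.of_forall fun z => ?_)
  have h1 : (-(1 / 2 : ℂ) * (‖z‖ : ℂ) ^ 2 + 0 * ((⟪(0 : EuclideanSpace ℝ (Fin n)), z⟫ : ℝ) : ℂ))
      = ((-(‖z‖ ^ 2) / 2 : ℝ) : ℂ) := by push_cast; ring
  simp only [h1, Complex.norm_exp_ofReal]

lemma bK_int {n : ℕ} (ξ : EuclideanSpace ℝ (Fin n)) : Integrable (bK ξ) :=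
  (gauss_int n).mono' (bK_cont ξ).aestronglyMeasurable
    (Filter.Eventually.of_forall fun z => (bK_norm ξ z).le)

lemma bargmann_eq (n : ℕ) (f : EuclideanSpace ℝ (Fin n) → ℂ) (x ξ : EuclideanSpace ℝ (Fin n)) :
    bargmann n f x ξ =
      ((2 : ℝ) ^ (-(n : ℝ) / 2) * Real.pi ^ (-(3 * (n : ℝ)) / 4) : ℝ) *
        ∫ z, bK ξ z * f (x - z) := by
  rw [bargmann, ← integral_sub_left_eq_self (fun z => bK ξ z * f (x - z)) volume x]
  simp only [sub_sub_cancel, bK]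

lemma u_int {n : ℕ} (u : SchwartzMap (EuclideanSpace ℝ (Fin n)) ℂ)
    (x : EuclideanSpace ℝ (Fin n)) : Integrable (fun z => u (x - z)) :=
  (u.integrable (μ := volume)).comp_sub_left x

lemma Ku_int {n : ℕ} (u : SchwartzMap (EuclideanSpace ℝ (Fin n)) ℂ)
    (x ξ : EuclideanSpace ℝ (Fin n)) : Integrable (fun z => bK ξ z * u (x - z)) :=
  (u_int u x).bdd_mul (bK_cont ξ).aestronglyMeasurable
    (Filter.Eventually.of_forall fun z => bK_norm_le ξ z)

lemma du_bound {n : ℕ} (u : SchwartzMap (EuclideanSpace ℝ (Fin n)) ℂ) :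
    ∃ C, ∀ y, ‖fderiv ℝ u y‖ ≤ C := by
  obtain ⟨C, -, hC⟩ := (SchwartzMap.fderivCLM ℝ (EuclideanSpace ℝ (Fin n)) ℂ u).decay 0 0
  exact ⟨C, fun y => by simpa using hC y⟩

lemma du_cont {n : ℕ} (u : SchwartzMap (EuclideanSpace ℝ (Fin n)) ℂ) :
    Continuous (fderiv ℝ u) :=
  (u.smooth 1).continuous_fderiv one_ne_zero

lemma deriv_x {n : ℕ} (u : SchwartzMap (EuclideanSpace ℝ (Fin n)) ℂ)
    (x ξ q : EuclideanSpace ℝ (Fin n)) :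
    Integrable (fun z => bK ξ z * fderiv ℝ u (x - z) q) ∧
    fderiv ℝ (fun x' => bargmann n u x' ξ) x q =
      ((2 : ℝ) ^ (-(n : ℝ) / 2) * Real.pi ^ (-(3 * (n : ℝ)) / 4) : ℝ) *
        ∫ z, bK ξ z * fderiv ℝ u (x - z) q := by
  obtain ⟨C, hC⟩ := du_bound u
  have hduc := du_cont u
  have hc : Continuous (fun z => bK ξ z • fderiv ℝ u (x - z)) :=
    (bK_cont ξ).smul (hduc.comp (by fun_prop))
  have hb : ∀ x' z, ‖bK ξ z • fderiv ℝ u (x' - z)‖ ≤ Real.exp (-(‖z‖ ^ 2) / 2) * C := by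
    intro x' z
    rw [norm_smul, bK_norm]
    gcongr
    exact hC _
  have hgi := (gauss_int n).mul_const C
  have hi : Integrable (fun z => bK ξ z • fderiv ℝ u (x - z)) :=
    hgi.mono' hc.aestronglyMeasurable (Filter.Eventually.of_forall (hb x))
  have hd : HasFDerivAt (fun x' => ∫ z, bK ξ z * u (x' - z))
      (∫ z, bK ξ z • fderiv ℝ u (x - z)) x := by
    refine hasFDerivAt_integral_of_dominated_of_fderiv_le (𝕜 := ℝ) (s := Set.univ)
      (F' := fun x' z => bK ξ z • fderiv ℝ u (x' - z))
      Filter.univ_mem (Filter.Eventually.of_forall fun x' => (Ku_int u x' ξ).aestronglyMeasurable)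
      (Ku_int u x ξ) hc.aestronglyMeasurable
      (Filter.Eventually.of_forall fun z x' _ => hb x' z) hgi
      (Filter.Eventually.of_forall fun z x' _ => ?_)
    have h1 : HasFDerivAt (fun x' => u (x' - z)) (fderiv ℝ u (x' - z)) x' := by
      rw [hasFDerivAt_comp_sub]
      exact u.differentiableAt.hasFDerivAt
    exact h1.const_mul (bK ξ z)
  refine ⟨?_, ?_⟩
  · simpa using hi.apply_continuousLinearMap q
  · simp only [bargmann_eq]
    rw [(hd.const_mul _).fderiv, smul_apply,
      ContinuousLinearMap.integral_apply hi]
    simp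

lemma deriv_xi {n : ℕ} (u : SchwartzMap (EuclideanSpace ℝ (Fin n)) ℂ)
    (x ξ p : EuclideanSpace ℝ (Fin n)) :
    Integrable (fun z => (bK ξ z * u (x - z)) * (⟪p, z⟫ : ℝ)) ∧
    fderiv ℝ (fun ξ' => bargmann n u x ξ') ξ p =
      ((2 : ℝ) ^ (-(n : ℝ) / 2) * Real.pi ^ (-(3 * (n : ℝ)) / 4) : ℝ) *
        (Complex.I * ∫ z, (bK ξ z * u (x - z)) * (⟪p, z⟫ : ℝ)) := by
  let A : EuclideanSpace ℝ (Fin n) → (EuclideanSpace ℝ (Fin n) →L[ℝ] ℂ) :=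
    fun z => Complex.ofRealCLM.comp (innerSL ℝ z)
  have hAa : ∀ z v, A z v = ((⟪v, z⟫ : ℝ) : ℂ) := fun z v => by
    simp [A, real_inner_comm]
  have hAn : ∀ z, ‖A z‖ ≤ ‖z‖ := fun z => by
    refine (ContinuousLinearMap.opNorm_comp_le _ _).trans ?_
    simp
  have hAc : Continuous A := by
    have : Continuous (fun z : EuclideanSpace ℝ (Fin n) => innerSL ℝ z) := (innerSL ℝ).continuous
    exact continuous_const.clm_comp this
  have huc : Continuous (fun z => u (x - z)) := u.continuous.comp (by fun_prop)
  have hc : Continuous (fun z => (bK ξ z * u (x - z) * Complex.I) • A z) :=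
    (((bK_cont ξ).mul huc).mul continuous_const).smul hAc
  have hb : ∀ ξ' z, ‖(bK ξ' z * u (x - z) * Complex.I) • A z‖ ≤ ‖u (x - z)‖ := by
    intro ξ' z
    rw [norm_smul, norm_mul, norm_mul, Complex.norm_I, mul_one]
    calc ‖bK ξ' z‖ * ‖u (x - z)‖ * ‖A z‖ ≤ ‖bK ξ' z‖ * ‖u (x - z)‖ * ‖z‖ := by
          gcongr
          exact hAn z
      _ = (‖bK ξ' z‖ * ‖z‖) * ‖u (x - z)‖ := by ring
      _ ≤ 1 * ‖u (x - z)‖ := by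
          gcongr
          exact bK_norm_mul_le ξ' z
      _ = _ := one_mul _
  have hgi := (u_int u x).norm
  have hi : Integrable (fun z => (bK ξ z * u (x - z) * Complex.I) • A z) :=
    hgi.mono' hc.aestronglyMeasurable (Filter.Eventually.of_forall (hb ξ))
  have hd : HasFDerivAt (fun ξ' => ∫ z, bK ξ' z * u (x - z))
      (∫ z, (bK ξ z * u (x - z) * Complex.I) • A z) ξ := by
    refine hasFDerivAt_integral_of_dominated_of_fderiv_le (𝕜 := ℝ) (s := Set.univ)
      (F' := fun ξ' z => (bK ξ' z * u (x - z) * Complex.I) • A z)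
      Filter.univ_mem (Filter.Eventually.of_forall fun ξ' => (Ku_int u x ξ').aestronglyMeasurable)
      (Ku_int u x ξ) hc.aestronglyMeasurable
      (Filter.Eventually.of_forall fun z ξ' _ => hb ξ' z) hgi
      (Filter.Eventually.of_forall fun z ξ' _ => ?_)
    have h0 : HasFDerivAt (fun v => ((⟪v, z⟫ : ℝ) : ℂ)) (A z) ξ' := by
      have h2 : (fun v => ((⟪v, z⟫ : ℝ) : ℂ)) = A z := funext fun v => (hAa z v).symm
      rw [h2]
      exact (A z).hasFDerivAt
    have h1 := (((h0.const_mul Complex.I).cexp).const_mul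
      (Complex.exp (-((‖z‖ : ℂ) ^ 2) / 2))).mul_const (u (x - z))
    refine h1.congr_fderiv ?_
    ext v
    simp [bK]
    ring
  have hi' := hi.apply_continuousLinearMap p
  have he : ∀ z, ((bK ξ z * u (x - z) * Complex.I) • A z) p =
      Complex.I * ((bK ξ z * u (x - z)) * (⟪p, z⟫ : ℝ)) := fun z => by
    rw [smul_apply, hAa, smul_eq_mul]; ring
  simp only [he] at hi'
  refine ⟨?_, ?_⟩
  · have := hi'.const_mul (-Complex.I)
    refine this.congr (Filter.Eventually.of_forall fun z => ?_)
    simp only [← mul_assoc]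
    simp
  · simp only [bargmann_eq]
    rw [(hd.const_mul _).fderiv, smul_apply,
      ContinuousLinearMap.integral_apply hi, ← integral_const_mul]
    simp only [he, smul_eq_mul]

/-- Exact conjugation formula: for an affine symbol `L(x,ξ) = c + p·x + q·ξ`, the
Bargmann transform intertwines the Weyl quantization `L^w(x,D)` with the first-order
operator `L(x,ξ) + i(p·∂_ξ − q·(∂_x − iξ))`. -/
theorem stmt17 (n : ℕ) (c : ℝ) (p q : EuclideanSpace ℝ (Fin n))
    (u : SchwartzMap (EuclideanSpace ℝ (Fin n)) ℂ)
    (Lwu : EuclideanSpace ℝ (Fin n) → ℂ)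
    -- `L^w(x,D) u (y) = (c + p·y) u(y) + q·D u(y)` with `D = -i∂`
    (hLw : ∀ y, Lwu y = ((c + ⟪p, y⟫ : ℝ) : ℂ) * u y -
      Complex.I * fderiv ℝ (u : EuclideanSpace ℝ (Fin n) → ℂ) y q)
    (x ξ : EuclideanSpace ℝ (Fin n)) :
    bargmann n Lwu x ξ =
      ((c + ⟪p, x⟫ + ⟪q, ξ⟫ : ℝ) : ℂ) * bargmann n u x ξ +
        Complex.I * (fderiv ℝ (fun ξ' => bargmann n u x ξ') ξ p -
          (fderiv ℝ (fun x' => bargmann n u x' ξ) x q -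
            Complex.I * (⟪ξ, q⟫ : ℝ) * bargmann n u x ξ)) := by
  obtain ⟨hi1, h1⟩ := deriv_x u x ξ q
  obtain ⟨hi2, h2⟩ := deriv_xi u x ξ p
  have hi0 := Ku_int u x ξ
  rw [h1, h2]
  simp only [bargmann_eq]
  have key : ∫ z, bK ξ z * Lwu (x - z) =
      ((c + ⟪p, x⟫ : ℝ) : ℂ) * (∫ z, bK ξ z * u (x - z)) -
        (∫ z, (bK ξ z * u (x - z)) * (⟪p, z⟫ : ℝ)) -
        Complex.I * ∫ z, bK ξ z * fderiv ℝ u (x - z) q := by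
    rw [← integral_const_mul, ← integral_const_mul,
      ← integral_sub (hi0.const_mul _) hi2]
    refine Eq.trans ?_ (integral_sub ((hi0.const_mul _).sub hi2) (hi1.const_mul _))
    refine integral_congr_ae (Filter.Eventually.of_forall fun z => ?_)
    simp only [hLw, inner_sub_right, Pi.sub_apply]
    push_cast
    ring
  rw [key, real_inner_comm ξ q]
  generalize (∫ z, bK ξ z * u (x - z)) = J
  generalize (∫ z, (bK ξ z * u (x - z)) * ((⟪p, z⟫ : ℝ) : ℂ)) = P
  generalize (∫ z, bK ξ z * fderiv ℝ u (x - z) q) = Q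
  generalize (2 : ℝ) ^ (-(n : ℝ) / 2) * Real.pi ^ (-(3 * (n : ℝ)) / 4) = C
  push_cast
  linear_combination (-((C : ℂ) * J * ((⟪ξ, q⟫ : ℝ) : ℂ) + C * P)) * Complex.I_sq
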